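/- arXiv:1812.11805 — 2 statements merged into one kernel-verified Lean document; each statement's English description precedes it below -/
import Mathlib

section
/- For every integer n ≥ 1, binom(2n,n)·(H_{2n−1} − H_n) = 2·Σ_{j=1}^{n−1} ((−1)^{j−1}/j)·binom(2n−1, n−j−1), where H_n = Σ_{k=1}^{n} 1/k is the n-th harmonic number (the identity holds in ℚ). -/
open Finset in
/-- The Pascal recursion for the coefficients of `(1 + t) ^ N * log (1 + t)`. -/
theorem sum_alternating_div_mul_choose_succ (N m : ℕ) :
    ∑ j ∈ range (m + 1), (-1 : ℚ) ^ j / (j + 1) * ((N + 1).choose (m - j) : ℚ) =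
      ∑ j ∈ range m, (-1 : ℚ) ^ j / (j + 1) * (N.choose (m - 1 - j) : ℚ) +
        ∑ j ∈ range (m + 1), (-1 : ℚ) ^ j / (j + 1) * (N.choose (m - j) : ℚ) := by
  rw [sum_range_succ, sum_range_succ _ m, ← add_assoc, ← sum_add_distrib]
  congr 1
  · refine sum_congr rfl fun j hj => ?_
    obtain ⟨k, rfl⟩ := Nat.exists_eq_add_of_lt (mem_range.mp hj)
    rw [show j + k + 1 - j = k + 1 by omega, show j + k + 1 - 1 - j = k by omega,
      Nat.choose_succ_succ]
    push_cast
    ring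
  · simp

open Finset in
theorem sum_alternating_div_mul_choose_self (N : ℕ) :
    ∑ j ∈ range (N + 1), (-1 : ℚ) ^ j / (j + 1) * (N.choose (N - j) : ℚ) = 1 / (N + 1) := by
  have alternating : ∑ j ∈ range (N + 2), (-1 : ℚ) ^ j * ((N + 1).choose j : ℚ) = 0 := by
    have h := Int.alternating_sum_range_choose_of_ne (Nat.succ_ne_zero N)
    exact_mod_cast h
  rw [sum_range_succ'] at alternating
  rw [eq_div_iff (by positivity), sum_mul]
  have termwise : ∀ j ∈ range (N + 1),
      (-1 : ℚ) ^ j / (j + 1) * (N.choose (N - j) : ℚ) * (N + 1) =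
        -((-1 : ℚ) ^ (j + 1) * ((N + 1).choose (j + 1) : ℚ)) := by
    intro j hj
    rw [Nat.choose_symm (Nat.lt_succ_iff.mp (mem_range.mp hj))]
    have h : ((N : ℚ) + 1) * N.choose j = (N + 1).choose (j + 1) * (j + 1) := by
      exact_mod_cast Nat.add_one_mul_choose_eq N j
    field_simp
    linear_combination (-1 : ℚ) ^ j * h
  rw [sum_congr rfl termwise, sum_neg_distrib]
  simp at alternating
  linarith

open Finset in
/-- The coefficient of `t ^ m` in `(1 + t) ^ N * log (1 + t)`, in terms of harmonic numbers. -/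
theorem sum_alternating_div_mul_choose (N m d : ℕ) (h : m + d = N) :
    ∑ j ∈ range m, (-1 : ℚ) ^ j / (j + 1) * (N.choose (m - 1 - j) : ℚ) =
      (N.choose m : ℚ) * (harmonic N - harmonic d) := by
  induction N generalizing m d with
  | zero =>
    obtain ⟨rfl, rfl⟩ : m = 0 ∧ d = 0 := by omega
    simp
  | succ N ih =>
    rcases m with _ | m
    · obtain rfl : d = N + 1 := by omega
      simp
    rw [Nat.add_sub_cancel, sum_alternating_div_mul_choose_succ, ih m d (by omega)]
    rcases d with _ | d
    · obtain rfl : m = N := by omega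
      rw [sum_alternating_div_mul_choose_self, harmonic_succ]
      simp
    · have step := ih (m + 1) d (by omega)
      rw [Nat.add_sub_cancel] at step
      rw [step, harmonic_succ, harmonic_succ, Nat.choose_succ_succ]
      obtain rfl : N = m + d + 1 := by omega
      have h₁ : ((m + d + 1).choose (m + 1) : ℚ) * (m + 1) =
          (m + d + 1).choose m * (d + 1) := by
        have := Nat.choose_succ_right_eq (m + d + 1) m
        rw [show m + d + 1 - m = d + 1 by omega] at this
        exact_mod_cast this
      have h₂ : ((m + d + 1).choose (m + 1) : ℚ) =
          (m + d + 1).choose m * (d + 1) / (m + 1) := by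
        rw [eq_div_iff (by positivity), h₁]
      push_cast
      rw [h₂]
      field_simp
      ring

/-- `binom(2n,n)·(H_{2n-1} - H_n) = 2·Σ_{j=1}^{n-1} ((-1)^{j-1}/j)·binom(2n-1, n-j-1)`. -/
theorem catalan_harmonic_identity (n : ℕ) (hn : 1 ≤ n) :
    (Nat.choose (2 * n) n : ℚ) * (harmonic (2 * n - 1) - harmonic n) =
      2 * ∑ j ∈ Finset.Icc 1 (n - 1),
        (-1 : ℚ) ^ (j - 1) / (j : ℚ) * (Nat.choose (2 * n - 1) (n - j - 1) : ℚ) := by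
  obtain ⟨m, rfl⟩ := Nat.exists_eq_add_of_le' hn
  have central : (2 * (m + 1)).choose (m + 1) = 2 * (2 * m + 1).choose m := by
    rw [show 2 * (m + 1) = 2 * m + 1 + 1 by ring, Nat.choose_succ_succ,
      Nat.choose_symm_half]
    ring
  rw [central, show 2 * (m + 1) - 1 = 2 * m + 1 by omega, Nat.add_sub_cancel,
    ← Finset.Ico_succ_right_eq_Icc, Finset.sum_Ico_eq_sum_range]
  push_cast
  rw [mul_assoc, ← sum_alternating_div_mul_choose (2 * m + 1) m (m + 1) (by omega)]
  congr 1
  refine Finset.sum_congr (by simp) fun j _ => ?_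
  rw [show 1 + j - 1 = j by omega, show m + 1 - (1 + j) - 1 = m - 1 - j by omega, add_comm (1 : ℚ)]
end

section
/- For every integer n ≥ 0, the unsigned Stirling number of the first kind satisfies [n+1, 3]/n! = (1/2)·H_n² − (1/2)·H_n^{(2)} in ℚ, where H_n = Σ_{k=1}^{n} 1/k and H_n^{(2)} = Σ_{k=1}^{n} 1/k². -/
/-- Unsigned Stirling numbers of the first kind (Stirling cycle numbers), via the
recurrence `[n+1, k+1] = n·[n, k+1] + [n, k]`. -/
def stirling1 : ℕ → ℕ → ℕ
  | 0, 0 => 1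
  | 0, _ + 1 => 0
  | _ + 1, 0 => 0
  | n + 1, k + 1 => n * stirling1 n (k + 1) + stirling1 n k

/-- Higher order harmonic numbers `H_n^{(i)} = Σ_{k=1}^n 1/k^i`. -/
def harmonicPow (n i : ℕ) : ℚ := ∑ k ∈ Finset.range n, 1 / ((k + 1 : ℚ)) ^ i

theorem stirling1_succ_succ (n k : ℕ) :
    stirling1 (n + 1) (k + 1) = n * stirling1 n (k + 1) + stirling1 n k := by
  rw [stirling1]

theorem stirling1_one_right (n : ℕ) : stirling1 (n + 1) 1 = n.factorial := by
  induction n with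
  | zero => simp [stirling1]
  | succ n ih =>
    rw [stirling1_succ_succ (n + 1) 0, ih, Nat.factorial_succ, stirling1, add_zero]

theorem stirling1_two_right (n : ℕ) :
    (stirling1 (n + 1) 2 : ℚ) = n.factorial * harmonic n := by
  induction n with
  | zero => simp [stirling1]
  | succ n ih =>
    rw [stirling1_succ_succ (n + 1) 1, stirling1_one_right, harmonic_succ, Nat.factorial_succ]
    push_cast
    rw [ih]
    field_simp

theorem harmonicPow_succ (n i : ℕ) :
    harmonicPow (n + 1) i = harmonicPow n i + 1 / ((n + 1 : ℚ)) ^ i :=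
  Finset.sum_range_succ ..

/-- `[n+1, 3]/n! = (1/2)·H_n² - (1/2)·H_n^{(2)}`. -/
theorem stirling1_three (n : ℕ) :
    (stirling1 (n + 1) 3 : ℚ) / (n.factorial : ℚ) =
      (1 / 2) * (harmonic n) ^ 2 - (1 / 2) * harmonicPow n 2 := by
  rw [div_eq_iff (by positivity)]
  induction n with
  | zero => simp [stirling1, harmonicPow]
  | succ n ih =>
    rw [stirling1_succ_succ (n + 1) 2, harmonic_succ, harmonicPow_succ, Nat.factorial_succ]
    push_cast
    rw [ih, stirling1_two_right]
    field_simp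
    ring
end
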